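/- There exist absolute constants c > 0 (chosen small enough) and C > 0 (chosen large enough) with the following property. Assume L_XᵀZ_{t+1}Q_t has full rank, max{‖Z_t‖, ‖Z_{t+1}‖} ≤ 2√‖X‖, ‖L_{X,⊥}ᵀP_{Z_tQ_t}‖ ≤ c, μ ≤ c/(‖X‖κ), and ‖Δ_t‖ ≤ cσ_min(X). Set β := ‖L_{X,⊥}ᵀP_{Z_tQ_t}‖·‖X‖ + ‖Z_tQ_{t,⊥}‖² + ‖Δ_t‖. Then ‖Z̃_{t+1}ᵀZ_{t+1}Q_{t+1,⊥}‖ ≤ ‖Z̃_tᵀZ_tQ_{t,⊥}‖ + Cμ((‖L_{X,⊥}ᵀP_{Z_tQ_t}‖ + μ‖X‖)β + μ‖X‖²)·√‖X‖·‖Z_tQ_{t,⊥}‖ + 8μβ‖Z_tQ_{t,⊥}‖². -/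

import Mathlib

open Matrix MeasureTheory ProbabilityTheory

noncomputable section

namespace AsymMatrixSensing

/-- Euclidean norm of a real vector. -/
def euclNorm {ι : Type*} [Fintype ι] (v : ι → ℝ) : ℝ :=
  Real.sqrt (∑ i, v i ^ 2)

/-- Spectral norm of a real matrix. -/
def specNorm {ι₁ ι₂ : Type*} [Fintype ι₁] [Fintype ι₂] (M : Matrix ι₁ ι₂ ℝ) : ℝ :=
  sSup {c : ℝ | ∃ x : ι₂ → ℝ, euclNorm x ≤ 1 ∧ c = euclNorm (M.mulVec x)}

/-- Frobenius norm of a real matrix. -/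
def frobNorm {ι₁ ι₂ : Type*} [Fintype ι₁] [Fintype ι₂] (M : Matrix ι₁ ι₂ ℝ) : ℝ :=
  Real.sqrt (∑ i, ∑ j, M i j ^ 2)

/-- Nuclear norm of a real matrix (characterized by duality with the spectral norm). -/
def nucNorm {ι₁ ι₂ : Type*} [Fintype ι₁] [Fintype ι₂] (M : Matrix ι₁ ι₂ ℝ) : ℝ :=
  sSup {c : ℝ | ∃ B : Matrix ι₁ ι₂ ℝ, specNorm B ≤ 1 ∧ c = ∑ i, ∑ j, M i j * B i j}

/-- Smallest singular value `σ_{min(a,b)}(M)` of a matrix. -/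
def sigmaMin {ι₁ ι₂ : Type*} [Fintype ι₁] [Fintype ι₂] (M : Matrix ι₁ ι₂ ℝ) : ℝ :=
  max (sInf {c : ℝ | ∃ x : ι₂ → ℝ, euclNorm x = 1 ∧ c = euclNorm (M.mulVec x)})
      (sInf {c : ℝ | ∃ y : ι₁ → ℝ, euclNorm y = 1 ∧ c = euclNorm (Mᵀ.mulVec y)})

/-- Smallest nonzero singular value `σ_rank(M)`: the minimum of `‖Mx‖` over unit
vectors `x` orthogonal to the kernel of `M`. -/
def sigmaPos {ι₁ ι₂ : Type*} [Fintype ι₁] [Fintype ι₂] (M : Matrix ι₁ ι₂ ℝ) : ℝ :=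
  sInf {c : ℝ | ∃ x : ι₂ → ℝ, euclNorm x = 1 ∧
    (∀ y : ι₂ → ℝ, M.mulVec y = 0 → x ⬝ᵥ y = 0) ∧ c = euclNorm (M.mulVec x)}

/-- Condition number `κ = ‖M‖ / σ_min(M)`. -/
def condNum {ι₁ ι₂ : Type*} [Fintype ι₁] [Fintype ι₂] (M : Matrix ι₁ ι₂ ℝ) : ℝ :=
  specNorm M / sigmaPos M

/-- Trace inner product `⟨M, N⟩ = trace(Mᵀ N)`. -/
def minner {ι₁ ι₂ : Type*} [Fintype ι₁] [Fintype ι₂] (M N : Matrix ι₁ ι₂ ℝ) : ℝ :=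
  ∑ i, ∑ j, M i j * N i j

/-- `P` is a matrix with orthonormal columns spanning the column space of `M`. -/
def IsOrthCol {ι κ₁ κ₂ : Type*} [Fintype ι] [Fintype κ₁] [Fintype κ₂] [DecidableEq κ₂]
    (P : Matrix ι κ₂ ℝ) (M : Matrix ι κ₁ ℝ) : Prop :=
  Pᵀ * P = 1 ∧ (∃ C : Matrix κ₁ κ₂ ℝ, P = M * C) ∧ P * Pᵀ * M = M

/-- `L` has orthonormal columns spanning the subspace spanned by eigenvectors of the
symmetric matrix `F` corresponding to its `r` largest eigenvalues. -/
def IsTopEigenspace {ι : Type*} [Fintype ι] [DecidableEq ι] {r : ℕ} (F : Matrix ι ι ℝ)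
    (L : Matrix ι (Fin r) ℝ) : Prop :=
  Lᵀ * L = 1 ∧ ∃ d : Fin r → ℝ, F * L = L * Matrix.diagonal d ∧
    ∀ (v : ι → ℝ) (lam : ℝ), v ≠ 0 → F.mulVec v = lam • v →
      Lᵀ.mulVec v = 0 → ∀ i, lam ≤ d i

variable {n₁ n₂ m k r : ℕ}

/-- The measurement operator `𝒜`, given by `[𝒜(Z)]ᵢ = ⟨Aᵢ, Z⟩`. -/
def calA (A : Fin m → Matrix (Fin n₁) (Fin n₂) ℝ) (Z : Matrix (Fin n₁) (Fin n₂) ℝ) :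
    Fin m → ℝ := fun i => minner (A i) Z

/-- The restricted isometry property of order `s` with constant `δ`. -/
def HasRIP (A : Fin m → Matrix (Fin n₁) (Fin n₂) ℝ) (s : ℕ) (δ : ℝ) : Prop :=
  ∀ M : Matrix (Fin n₁) (Fin n₂) ℝ, M.rank ≤ s →
    (1 - δ) * frobNorm M ^ 2 ≤ ∑ i, calA A M i ^ 2 ∧
      ∑ i, calA A M i ^ 2 ≤ (1 + δ) * frobNorm M ^ 2

/-- `𝒜*𝒜`. -/
def AstarA (A : Fin m → Matrix (Fin n₁) (Fin n₂) ℝ) (Z : Matrix (Fin n₁) (Fin n₂) ℝ) :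
    Matrix (Fin n₁) (Fin n₂) ℝ := ∑ i, minner (A i) Z • A i

/-- The symmetrization `sym(X) = [[0, X], [Xᵀ, 0]]`. -/
def symMat (X : Matrix (Fin n₁) (Fin n₂) ℝ) :
    Matrix (Fin n₁ ⊕ Fin n₂) (Fin n₁ ⊕ Fin n₂) ℝ := Matrix.fromBlocks 0 X Xᵀ 0

/-- The symmetrized measurement matrices `Bᵢ = (1/√2)[[0, Aᵢ], [Aᵢᵀ, 0]]`. -/
def Bmat (A : Fin m → Matrix (Fin n₁) (Fin n₂) ℝ) (i : Fin m) :
    Matrix (Fin n₁ ⊕ Fin n₂) (Fin n₁ ⊕ Fin n₂) ℝ :=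
  (Real.sqrt 2)⁻¹ • Matrix.fromBlocks 0 (A i) (A i)ᵀ 0

/-- `ℬ*ℬ`. -/
def BstarB (A : Fin m → Matrix (Fin n₁) (Fin n₂) ℝ)
    (S : Matrix (Fin n₁ ⊕ Fin n₂) (Fin n₁ ⊕ Fin n₂) ℝ) :
    Matrix (Fin n₁ ⊕ Fin n₂) (Fin n₁ ⊕ Fin n₂) ℝ :=
  ∑ i, minner (Bmat A i) S • Bmat A i

/-- The factorized gradient descent iterates `(V_t, W_t)`. -/
def iter (A : Fin m → Matrix (Fin n₁) (Fin n₂) ℝ) (X : Matrix (Fin n₁) (Fin n₂) ℝ)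
    (μ : ℝ) (V₀ : Matrix (Fin n₁) (Fin k) ℝ) (W₀ : Matrix (Fin n₂) (Fin k) ℝ) :
    ℕ → Matrix (Fin n₁) (Fin k) ℝ × Matrix (Fin n₂) (Fin k) ℝ
  | 0 => (V₀, W₀)
  | t + 1 =>
    let p := iter A X μ V₀ W₀ t
    let G := AstarA A (p.1 * p.2ᵀ - X)
    (p.1 - μ • (G * p.2), p.2 - μ • (Gᵀ * p.1))

/-- The vertical stacking `(1/√2)[V; W]`. -/
def Zstack {κ : ℕ} (V : Matrix (Fin n₁) (Fin κ) ℝ) (W : Matrix (Fin n₂) (Fin κ) ℝ) :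
    Matrix (Fin n₁ ⊕ Fin n₂) (Fin κ) ℝ :=
  (Real.sqrt 2)⁻¹ • Matrix.fromRows V W

/-- `Z_t = (1/√2)[V_t; W_t]`. -/
def Zit (A : Fin m → Matrix (Fin n₁) (Fin n₂) ℝ) (X : Matrix (Fin n₁) (Fin n₂) ℝ)
    (μ : ℝ) (V₀ : Matrix (Fin n₁) (Fin k) ℝ) (W₀ : Matrix (Fin n₂) (Fin k) ℝ) (t : ℕ) :
    Matrix (Fin n₁ ⊕ Fin n₂) (Fin k) ℝ :=
  Zstack (iter A X μ V₀ W₀ t).1 (iter A X μ V₀ W₀ t).2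

/-- `Z̃_t = (1/√2)[V_t; −W_t]`. -/
def Ztil (A : Fin m → Matrix (Fin n₁) (Fin n₂) ℝ) (X : Matrix (Fin n₁) (Fin n₂) ℝ)
    (μ : ℝ) (V₀ : Matrix (Fin n₁) (Fin k) ℝ) (W₀ : Matrix (Fin n₂) (Fin k) ℝ) (t : ℕ) :
    Matrix (Fin n₁ ⊕ Fin n₂) (Fin k) ℝ :=
  Zstack (iter A X μ V₀ W₀ t).1 (-(iter A X μ V₀ W₀ t).2)

/-- `Δ_t = (Id − ℬ*ℬ)(Z_tZ_tᵀ − Z̃_tZ̃_tᵀ − sym(X))`. -/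
def Δit (A : Fin m → Matrix (Fin n₁) (Fin n₂) ℝ) (X : Matrix (Fin n₁) (Fin n₂) ℝ)
    (μ : ℝ) (V₀ : Matrix (Fin n₁) (Fin k) ℝ) (W₀ : Matrix (Fin n₂) (Fin k) ℝ) (t : ℕ) :
    Matrix (Fin n₁ ⊕ Fin n₂) (Fin n₁ ⊕ Fin n₂) ℝ :=
  let D := Zit A X μ V₀ W₀ t * (Zit A X μ V₀ W₀ t)ᵀ
    - Ztil A X μ V₀ W₀ t * (Ztil A X μ V₀ W₀ t)ᵀ - symMat X
  D - BstarB A D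

/-- The block diagonal matrix `diag(Id_{n₁}, −Id_{n₂})`. -/
def flipSign (n₁ n₂ : ℕ) : Matrix (Fin n₁ ⊕ Fin n₂) (Fin n₁ ⊕ Fin n₂) ℝ :=
  Matrix.fromBlocks 1 0 0 (-1)

/-- Product Gaussian measure modelling the random initialization pair `(V, W)`
with i.i.d. standard Gaussian entries. -/
def gaussPair (n₁ n₂ k : ℕ) :
    Measure ((Fin n₁ → Fin k → ℝ) × (Fin n₂ → Fin k → ℝ)) :=
  (Measure.pi fun _ : Fin n₁ => Measure.pi fun _ : Fin k => gaussianReal 0 1).prod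
    (Measure.pi fun _ : Fin n₂ => Measure.pi fun _ : Fin k => gaussianReal 0 1)

section Helpers
open scoped Matrix.Norms.L2Operator

lemma nmul {a b c : Type*} [Fintype a] [Fintype b] [Fintype c] [DecidableEq b] [DecidableEq c]
    {A : Matrix a b ℝ} {B : Matrix b c ℝ} {x y : ℝ} (hA : ‖A‖ ≤ x) (hB : ‖B‖ ≤ y) :
    ‖A * B‖ ≤ x * y :=
  (Matrix.l2_opNorm_mul A B).trans
    (mul_le_mul hA hB (norm_nonneg _) ((norm_nonneg _).trans hA))

lemma ntr {a b : Type*} [Fintype a] [Fintype b] [DecidableEq a] [DecidableEq b]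
    (A : Matrix a b ℝ) : ‖Aᵀ‖ = ‖A‖ := by
  rw [← Matrix.conjTranspose_eq_transpose_of_trivial, Matrix.l2_opNorm_conjTranspose]

lemma none_le {a : Type*} [Fintype a] [DecidableEq a] : ‖(1 : Matrix a a ℝ)‖ ≤ 1 := by
  have h := Matrix.l2_opNorm_conjTranspose_mul_self (1 : Matrix a a ℝ)
  simp only [Matrix.conjTranspose_one, Matrix.mul_one] at h
  nlinarith [norm_nonneg (1 : Matrix a a ℝ)]

lemma northo {a b : Type*} [Fintype a] [Fintype b] [DecidableEq a] [DecidableEq b]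
    {A : Matrix a b ℝ} (h : Aᵀ * A = 1) : ‖A‖ ≤ 1 := by
  have h2 := Matrix.l2_opNorm_conjTranspose_mul_self A
  rw [Matrix.conjTranspose_eq_transpose_of_trivial, h] at h2
  nlinarith [norm_nonneg A, none_le (a := b)]

lemma euclNorm_eq {a : Type*} [Fintype a] (v : a → ℝ) : euclNorm v = ‖WithLp.toLp 2 v‖ := by
  simp [euclNorm, EuclideanSpace.norm_eq]

lemma euclNorm_mulVec_le {a b : Type*} [Fintype a] [Fintype b] [DecidableEq b]
    (M : Matrix a b ℝ) (v : b → ℝ) : euclNorm (M.mulVec v) ≤ ‖M‖ * euclNorm v := by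
  rw [euclNorm_eq, euclNorm_eq]
  exact Matrix.l2_opNorm_mulVec M (WithLp.toLp 2 v)

lemma specNorm_eq {a b : Type*} [Fintype a] [Fintype b] [DecidableEq b]
    (M : Matrix a b ℝ) : specNorm M = ‖M‖ := by
  have hbdd : ∀ c ∈ {c : ℝ | ∃ x : b → ℝ, euclNorm x ≤ 1 ∧ c = euclNorm (M.mulVec x)},
      c ≤ ‖M‖ := by
    rintro c ⟨x, hx, rfl⟩
    have := euclNorm_mulVec_le M x
    nlinarith [norm_nonneg M]
  have h0 : (0 : ℝ) ∈ {c : ℝ | ∃ x : b → ℝ, euclNorm x ≤ 1 ∧ c = euclNorm (M.mulVec x)} :=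
    ⟨0, by simp [euclNorm], by simp [euclNorm]⟩
  apply le_antisymm
  · exact csSup_le ⟨0, h0⟩ hbdd
  · rw [Matrix.l2_opNorm_def]
    have hs0 : 0 ≤ specNorm M := le_csSup ⟨_, hbdd⟩ h0
    refine ContinuousLinearMap.opNorm_le_bound _ hs0 fun x => ?_
    by_cases hx : ‖x‖ = 0
    · have : x = 0 := norm_eq_zero.mp hx
      subst this; simp
    have hxp : 0 < ‖x‖ := lt_of_le_of_ne (norm_nonneg _) (Ne.symm hx)
    have hmem : euclNorm (M.mulVec (‖x‖⁻¹ • x.ofLp)) ≤ specNorm M := by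
      refine le_csSup ⟨_, hbdd⟩ ⟨_, ?_, rfl⟩
      rw [euclNorm_eq, WithLp.toLp_smul, norm_smul]
      simp [hx]
    rw [Matrix.mulVec_smul, euclNorm_eq, WithLp.toLp_smul, norm_smul, norm_inv, norm_norm,
      inv_mul_le_iff₀ hxp] at hmem
    rw [mul_comm]
    exact hmem

lemma ortho_compl {a b c : Type*} [Fintype a] [Fintype b] [Fintype c] [DecidableEq a]
    [DecidableEq b] [DecidableEq c] {A : Matrix a b ℝ} {B : Matrix a c ℝ}
    (hA : Aᵀ * A = 1) (hB : Bᵀ * B = 1) (hAB : Aᵀ * B = 0)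
    (hc : Fintype.card a = Fintype.card b + Fintype.card c) : A * Aᵀ + B * Bᵀ = 1 := by
  have hBA : Bᵀ * A = 0 := by
    have := congrArg Matrix.transpose hAB
    simpa using this
  have e : a ≃ b ⊕ c := Fintype.equivOfCardEq (by simpa using hc)
  rw [← Matrix.fromCols_mul_fromRows, Matrix.fromCols_mul_fromRows_eq_one_comm e,
    Matrix.fromRows_mul_fromCols, hA, hB, hAB, hBA, Matrix.fromBlocks_one]

lemma ortho_card {a b : ℕ} {A : Matrix (Fin a) (Fin b) ℝ} (hA : Aᵀ * A = 1) : b ≤ a := by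
  have h := Matrix.rank_mul_le_right Aᵀ A
  rw [hA, Matrix.rank_one] at h
  simpa using h.trans (Matrix.rank_le_card_height A)

set_option maxHeartbeats 4000000 in
lemma core {n k r p q : Type*} [Fintype n] [Fintype k] [Fintype r] [Fintype p] [Fintype q]
    [DecidableEq n] [DecidableEq k] [DecidableEq r] [DecidableEq p] [DecidableEq q]
    (Z Zn Zn' : Matrix n k ℝ) (J M Xh Δ : Matrix n n ℝ) (L P : Matrix n r ℝ) (Lp : Matrix n p ℝ)
    (Q : Matrix k r ℝ) (Qp Qsp : Matrix k q ℝ) (D : Matrix r r ℝ) (μ x w : ℝ)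
    (hJ : Jᵀ = J) (hJ1 : ‖J‖ ≤ 1) (hM : Mᵀ = M)
    (hMd : M = Xh - Z * Zᵀ + (J * Z) * (J * Z)ᵀ + Δ)
    (hXh : Lᵀ * Xh = D * Lᵀ) (hL : Lᵀ * L = 1) (hLp : Lpᵀ * Lp = 1)
    (hI : L * Lᵀ + Lp * Lpᵀ = 1) (hJL : Lᵀ * J * L = 0)
    (hQ1 : Qᵀ * Q = 1) (hQ2 : Lᵀ * Z * Q * Qᵀ = Lᵀ * Z) (hQI : Q * Qᵀ + Qp * Qpᵀ = 1)
    (hQp1 : Qpᵀ * Qp = 1) (hQQp : Qᵀ * Qp = 0) (hQsp1 : Qspᵀ * Qsp = 1)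
    (hs0 : Lᵀ * Zn * Qsp = 0)
    (hP1 : Pᵀ * P = 1) (hP : P * Pᵀ * (Z * Q) = Z * Q)
    (hU : IsUnit (Lᵀ * Zn * Q))
    (hZn : Zn = Z + μ • (M * Z)) (hZn' : Zn' = J * Z - μ • (M * (J * Z)))
    (hμ : 0 < μ) (hw : 0 ≤ w) (hwx : w ^ 2 = x) (hZb : ‖Z‖ ≤ 2 * w) (hXb : ‖Xh‖ ≤ 2 * x)
    (hsb : ‖Lpᵀ * P‖ ≤ 1 / 100) (hμx : μ * x ≤ 1 / 100) (hΔb : ‖Δ‖ ≤ x)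
    (β : ℝ) (hβ : β = ‖Lpᵀ * P‖ * x + ‖Z * Qp‖ ^ 2 + ‖Δ‖) :
    ‖Zn'ᵀ * Zn * Qsp‖ ≤ ‖(J * Z)ᵀ * Z * Qp‖
      + 500 * μ * ((‖Lpᵀ * P‖ + μ * x) * β + μ * x ^ 2) * w * ‖Z * Qp‖
      + 8 * μ * β * ‖Z * Qp‖ ^ 2 := by
  set E := Lpᵀ * P with hE
  set Y := Z * Qp with hY
  set s := ‖E‖ with hs
  set y := ‖Y‖ with hy
  set d := ‖Δ‖ with hd
  have hs0' : 0 ≤ s := norm_nonneg _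
  have hy0 : 0 ≤ y := norm_nonneg _
  have hd0 : 0 ≤ d := norm_nonneg _
  have hx0 : 0 ≤ x := by rw [← hwx]; positivity
  have hβ0 : 0 ≤ β := by rw [hβ]; positivity
  have hQn := northo hQ1
  have hQpn := northo hQp1
  have hQspn := northo hQsp1
  have hLn := northo hL
  have hLpn := northo hLp
  have hPn := northo hP1
  have hLt : ‖Lᵀ‖ ≤ 1 := by rwa [ntr]
  have hLpt : ‖Lpᵀ‖ ≤ 1 := by rwa [ntr]
  have hPt : ‖Pᵀ‖ ≤ 1 := by rwa [ntr]
  have hQt : ‖Qᵀ‖ ≤ 1 := by rwa [ntr]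
  have hQpt : ‖Qpᵀ‖ ≤ 1 := by rwa [ntr]
  have hZt : ‖Zᵀ‖ ≤ 2 * w := by rwa [ntr]
  have hJZ : ‖J * Z‖ ≤ 2 * w := by simpa using nmul hJ1 hZb
  have hJZt : ‖(J * Z)ᵀ‖ ≤ 2 * w := by rwa [ntr]
  have hy2 : y ≤ 2 * w := by simpa using nmul hZb hQpn
  -- norm of M
  have hMn : ‖M‖ ≤ 11 * x := by
    have a1 : ‖Z * Zᵀ‖ ≤ 2 * w * (2 * w) := nmul hZb hZt
    have a2 : ‖(J * Z) * (J * Z)ᵀ‖ ≤ 2 * w * (2 * w) := nmul hJZ hJZt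
    have a3 := norm_add_le (Xh - Z * Zᵀ + (J * Z) * (J * Z)ᵀ) Δ
    have a4 := norm_add_le (Xh - Z * Zᵀ) ((J * Z) * (J * Z)ᵀ)
    have a5 := norm_sub_le Xh (Z * Zᵀ)
    rw [hMd]
    have a6 : 2 * w * (2 * w) = 4 * x := by rw [← hwx]; ring
    linarith
  -- basic identities
  set G := Pᵀ * (Z * Q) with hG
  have hPG : P * G = Z * Q := by rw [hG, ← Matrix.mul_assoc, hP]
  have hGn : ‖G‖ ≤ 2 * w := by simpa using nmul hPt (nmul hZb hQn)
  have hLY : Lᵀ * Y = 0 := by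
    rw [hY, ← Matrix.mul_assoc, ← hQ2, Matrix.mul_assoc, hQQp, Matrix.mul_zero]
  have hPY : Pᵀ * Y = Eᵀ * (Lpᵀ * Y) := by
    calc Pᵀ * Y = Pᵀ * ((L * Lᵀ + Lp * Lpᵀ) * Y) := by rw [hI, Matrix.one_mul]
      _ = Pᵀ * (L * (Lᵀ * Y)) + Pᵀ * (Lp * (Lpᵀ * Y)) := by
          simp only [Matrix.add_mul, Matrix.mul_add, Matrix.mul_assoc]
      _ = Eᵀ * (Lpᵀ * Y) := by
          rw [hLY, hE, Matrix.transpose_mul, Matrix.transpose_transpose]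
          simp only [Matrix.mul_zero, zero_add, Matrix.mul_assoc]
  have hPYn : ‖Pᵀ * Y‖ ≤ s * y := by
    rw [hPY]
    have : ‖Eᵀ‖ ≤ s := (ntr E).le
    simpa using nmul this (nmul hLpt (le_refl ‖Y‖))
  have hLJP : Lᵀ * J * P = Lᵀ * J * Lp * E := by
    calc Lᵀ * J * P = Lᵀ * J * ((L * Lᵀ + Lp * Lpᵀ) * P) := by rw [hI, Matrix.one_mul]
      _ = Lᵀ * J * L * (Lᵀ * P) + Lᵀ * J * Lp * (Lpᵀ * P) := by
          simp only [Matrix.add_mul, Matrix.mul_add, Matrix.mul_assoc]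
      _ = _ := by rw [hJL, Matrix.zero_mul, zero_add]
  have hLJPn : ‖Lᵀ * J * P‖ ≤ s := by
    rw [hLJP]
    simpa using nmul (nmul (nmul hLt hJ1) hLpn) (le_refl ‖E‖)
  have hPJP : ‖Pᵀ * J * P‖ ≤ 2 * s := by
    have e : Pᵀ * J * P = (Lᵀ * J * P)ᵀ * (Lᵀ * P) + Pᵀ * J * Lp * E := by
      calc Pᵀ * J * P = Pᵀ * J * ((L * Lᵀ + Lp * Lpᵀ) * P) := by rw [hI, Matrix.one_mul]
        _ = _ := by
          simp only [Matrix.add_mul, Matrix.mul_add, Matrix.mul_assoc, Matrix.transpose_mul,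
            Matrix.transpose_transpose, hJ, hE]
    rw [e]
    have b1 : ‖(Lᵀ * J * P)ᵀ‖ ≤ s := by rwa [ntr]
    have b2 := nmul b1 (nmul hLt hPn)
    have b3 := nmul (nmul (nmul hPt hJ1) hLpn) (le_refl ‖E‖)
    have b4 := norm_add_le ((Lᵀ * J * P)ᵀ * (Lᵀ * P)) (Pᵀ * J * Lp * E)
    linarith
  -- the matrix F
  set F := Lᵀ * M * Y with hF
  have hFm : ‖F‖ ≤ 11 * x * y := by
    simpa using nmul (nmul hLt hMn) (le_refl ‖Y‖)
  have hFn : ‖F‖ ≤ 8 * β * y := by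
    have e1 : Lᵀ * Z * Zᵀ * Y = (Lᵀ * Z * Q) * (Gᵀ * (Pᵀ * Y)) := by
      have : (Z * Q)ᵀ = Gᵀ * Pᵀ := by rw [← hPG, Matrix.transpose_mul]
      rw [← Matrix.mul_assoc Gᵀ, ← this, Matrix.transpose_mul]
      conv_lhs => rw [← hQ2]
      simp only [Matrix.mul_assoc]
    have n1 : ‖Lᵀ * Z * Zᵀ * Y‖ ≤ 4 * x * s * y := by
      rw [e1]
      have hGt : ‖Gᵀ‖ ≤ 2 * w := by rwa [ntr]
      have := nmul (nmul (nmul hLt hZb) hQn) (nmul hGt hPYn)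
      refine this.trans (le_of_eq ?_)
      rw [← hwx]; ring
    have e2 : Lᵀ * (J * Z) * (J * Z)ᵀ * Y
        = (Lᵀ * J * P) * G * Qᵀ * ((J * Z)ᵀ * Y) + Lᵀ * (J * Y) * ((J * Y)ᵀ * Y) := by
      have : J * Z = J * P * G * Qᵀ + J * Y * Qpᵀ := by
        calc J * Z = J * (Z * (Q * Qᵀ + Qp * Qpᵀ)) := by rw [hQI, Matrix.mul_one]
          _ = J * (Z * Q) * Qᵀ + J * Y * Qpᵀ := by
            simp only [Matrix.mul_add, Matrix.mul_assoc, hY]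
          _ = _ := by rw [← hPG]; simp only [Matrix.mul_assoc]
      have h' : (J * Y)ᵀ = Qpᵀ * (J * Z)ᵀ := by
        rw [← Matrix.transpose_mul, hY, Matrix.mul_assoc]
      rw [h']
      conv_lhs => rw [Matrix.mul_assoc, Matrix.mul_assoc]; arg 2; arg 1; rw [this]
      simp only [Matrix.mul_add, Matrix.add_mul, Matrix.mul_assoc]
    have n2 : ‖Lᵀ * (J * Z) * (J * Z)ᵀ * Y‖ ≤ 4 * x * s * y + y ^ 3 := by
      rw [e2]
      have c1 := nmul (nmul (nmul hLJPn hGn) hQt) (nmul hJZt (le_refl ‖Y‖))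
      have hJY : ‖J * Y‖ ≤ y := by simpa using nmul hJ1 (le_refl ‖Y‖)
      have hJYt : ‖(J * Y)ᵀ‖ ≤ y := by rwa [ntr]
      have c2 := nmul (nmul hLt hJY) (nmul hJYt (le_refl ‖Y‖))
      have c3 := norm_add_le ((Lᵀ * J * P) * G * Qᵀ * ((J * Z)ᵀ * Y))
        (Lᵀ * (J * Y) * ((J * Y)ᵀ * Y))
      rw [← hy] at c1 c2
      calc _ ≤ _ := c3
        _ ≤ _ := add_le_add c1 c2
        _ = _ := by rw [← hwx]; ring
    have n3 : ‖Lᵀ * Δ * Y‖ ≤ d * y := by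
      simpa using nmul (nmul hLt (le_refl ‖Δ‖)) (le_refl ‖Y‖)
    have e3 : F = Lᵀ * (J * Z) * (J * Z)ᵀ * Y - Lᵀ * Z * Zᵀ * Y + Lᵀ * Δ * Y := by
      have e0 : Lᵀ * Xh * Y = 0 := by rw [hXh, Matrix.mul_assoc, hLY, Matrix.mul_zero]
      have : F = Lᵀ * Xh * Y - Lᵀ * Z * Zᵀ * Y + Lᵀ * (J * Z) * (J * Z)ᵀ * Y + Lᵀ * Δ * Y := by
        rw [hF]; conv_lhs => rw [hMd]
        simp only [Matrix.mul_add, Matrix.add_mul, Matrix.mul_sub, Matrix.sub_mul,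
          Matrix.mul_assoc]
      rw [this, e0]; abel
    have f1 := norm_add_le (Lᵀ * (J * Z) * (J * Z)ᵀ * Y - Lᵀ * Z * Zᵀ * Y) (Lᵀ * Δ * Y)
    have f2 := norm_sub_le (Lᵀ * (J * Z) * (J * Z)ᵀ * Y) (Lᵀ * Z * Zᵀ * Y)
    rw [← e3] at f1
    have f3 : 0 ≤ d * y := by positivity
    have f4 : 0 ≤ y ^ 3 := by positivity
    have : 8 * β * y = 8 * x * s * y + 8 * y ^ 3 + 8 * (d * y) := by rw [hβ]; ring
    linarith
  -- the matrix K
  set N := Lᵀ * P + μ • (Lᵀ * M * P) with hN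
  have hNG : N * G = Lᵀ * Zn * Q := by
    rw [hN, hZn]
    simp only [Matrix.add_mul, Matrix.mul_add, Matrix.smul_mul, Matrix.mul_smul, Matrix.mul_assoc,
      hPG]
  obtain ⟨U, hU1⟩ := hU.exists_right_inv
  set K := G * U with hK
  have hNK : N * K = 1 := by rw [hK, ← Matrix.mul_assoc, hNG, hU1]
  have hKN : K * N = 1 := mul_eq_one_comm.mp hNK
  have hμM : μ * ‖M‖ ≤ 11 * (μ * x) := by nlinarith
  have hμx0 : 0 ≤ μ * x := by positivity
  have hKn : ‖K‖ ≤ 1 + 2 * s + 22 * (μ * x) := by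
    have g1 : (Lᵀ * P)ᵀ * (Lᵀ * P) + Eᵀ * E = 1 := by
      calc _ = Pᵀ * ((L * Lᵀ + Lp * Lpᵀ) * P) := by
            simp only [hE, Matrix.transpose_mul, Matrix.transpose_transpose, Matrix.add_mul,
              Matrix.mul_add, Matrix.mul_assoc]
        _ = 1 := by rw [hI, Matrix.one_mul, hP1]
    have g2 : K = Eᵀ * E * K + (Lᵀ * P)ᵀ * (1 - μ • (Lᵀ * M * P * K)) := by
      have : Lᵀ * P * K = 1 - μ • (Lᵀ * M * P * K) := by
        rw [← hNK, hN, Matrix.add_mul, Matrix.smul_mul]; abel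
      rw [← this, ← Matrix.mul_assoc (Lᵀ * P)ᵀ, ← Matrix.add_mul, add_comm, g1, Matrix.one_mul]
    have hEt : ‖Eᵀ‖ ≤ s := (ntr E).le
    have g3 := nmul (nmul hEt (le_refl ‖E‖)) (le_refl ‖K‖)
    have g4 : ‖μ • (Lᵀ * M * P * K)‖ ≤ μ * (‖M‖ * ‖K‖) := by
      rw [norm_smul, Real.norm_of_nonneg hμ.le]
      have := nmul (nmul (nmul hLt (le_refl ‖M‖)) hPn) (le_refl ‖K‖)
      exact mul_le_mul_of_nonneg_left (by simpa using this) hμ.le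
    have g5 := norm_sub_le (1 : Matrix r r ℝ) (μ • (Lᵀ * M * P * K))
    have g6 : ‖(Lᵀ * P)ᵀ‖ ≤ 1 := by rw [ntr]; simpa using nmul hLt hPn
    have g7 := nmul g6 (le_refl ‖(1 : Matrix r r ℝ) - μ • (Lᵀ * M * P * K)‖)
    have g8 := norm_add_le (Eᵀ * E * K) ((Lᵀ * P)ᵀ * (1 - μ • (Lᵀ * M * P * K)))
    rw [← g2] at g8
    have g9 := none_le (a := r)
    have hK0 := norm_nonneg K
    have hμM' : μ * (‖M‖ * ‖K‖) ≤ 11 * (μ * x) * ‖K‖ := by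
      rw [← mul_assoc]; exact mul_le_mul_of_nonneg_right hμM hK0
    have g10 : ‖K‖ ≤ s * s * ‖K‖ + (1 + 11 * (μ * x) * ‖K‖) := by
      rw [← hs] at g3; linarith
    have g11 : s * s * ‖K‖ ≤ s * ‖K‖ :=
      mul_le_mul_of_nonneg_right (by nlinarith) hK0
    have g12 : ‖K‖ * (1 - (s + 11 * (μ * x))) ≤ 1 := by nlinarith
    have g13 : 1 ≤ (1 + 2 * s + 22 * (μ * x)) * (1 - (s + 11 * (μ * x))) := by
      have : 0 ≤ (s + 11 * (μ * x)) * (1 - 2 * (s + 11 * (μ * x))) :=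
        mul_nonneg (by linarith) (by linarith)
      nlinarith
    exact le_of_mul_le_mul_right (g12.trans g13) (by linarith)
  have hK2 : ‖K‖ ≤ 2 := by linarith
  -- decomposition of Z * Qsp
  set S := Qpᵀ * Qsp with hS
  have hSn : ‖S‖ ≤ 1 := by simpa using nmul hQpt hQspn
  have hQd : Qsp = Q * (Qᵀ * Qsp) + Qp * S := by
    rw [hS, ← Matrix.mul_assoc, ← Matrix.mul_assoc, ← Matrix.add_mul, hQI, Matrix.one_mul]
  have hLZnQp : Lᵀ * Zn * Qp = μ • F := by
    have : Lᵀ * Zn * Qp = Lᵀ * Y + μ • F := by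
      rw [hZn, hF, hY]
      simp only [Matrix.mul_add, Matrix.add_mul, Matrix.smul_mul, Matrix.mul_smul,
        Matrix.mul_assoc]
    rw [this, hLY, zero_add]
  have hNGT : N * (G * (Qᵀ * Qsp)) = -(μ • (F * S)) := by
    have h : Lᵀ * Zn * Qsp = Lᵀ * Zn * Q * (Qᵀ * Qsp) + Lᵀ * Zn * Qp * S := by
      conv_lhs => rw [hQd]
      simp only [Matrix.mul_add, Matrix.mul_assoc]
    rw [hs0, hLZnQp, ← hNG, Matrix.smul_mul, Matrix.mul_assoc] at h
    exact eq_neg_of_add_eq_zero_left h.symm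
  have hGT : G * (Qᵀ * Qsp) = -(μ • (K * (F * S))) := by
    calc _ = K * (N * (G * (Qᵀ * Qsp))) := by rw [← Matrix.mul_assoc K, hKN, Matrix.one_mul]
      _ = _ := by rw [hNGT, Matrix.mul_neg, Matrix.mul_smul]
  have hZQ : Z * Qsp = Y * S - μ • (P * (K * (F * S))) := by
    have : Z * Qsp = P * (G * (Qᵀ * Qsp)) + Y * S := by
      conv_lhs => rw [hQd]
      rw [← Matrix.mul_assoc P, hPG, hY]
      simp only [Matrix.mul_add, Matrix.mul_assoc]
    rw [this, hGT, Matrix.mul_neg, Matrix.mul_smul]; abel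
  have hZQn : ‖Z * Qsp‖ ≤ 2 * y := by
    rw [hZQ]
    have i1 := nmul (le_refl ‖Y‖) hSn
    have i2 := nmul hPn (nmul hK2 (nmul hFm hSn))
    have i3 := norm_sub_le (Y * S) (μ • (P * (K * (F * S))))
    rw [norm_smul, Real.norm_of_nonneg hμ.le] at i3
    have i4 := mul_le_mul_of_nonneg_left i2 hμ.le
    have i5 : μ * x * y ≤ 1 / 100 * y := mul_le_mul_of_nonneg_right hμx hy0
    rw [← hy] at i1
    linarith
  have hJZP : ‖(J * Z)ᵀ * P‖ ≤ 4 * w * s + y := by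
    have e : (J * Z)ᵀ * P = Q * (Gᵀ * (Pᵀ * J * P)) + Qp * (Yᵀ * (J * P)) := by
      have : Zᵀ = Q * (Gᵀ * Pᵀ) + Qp * Yᵀ := by
        rw [← Matrix.transpose_mul, hPG, hY, Matrix.transpose_mul, Matrix.transpose_mul,
          ← Matrix.mul_assoc, ← Matrix.mul_assoc, ← Matrix.add_mul, hQI, Matrix.one_mul]
      rw [Matrix.transpose_mul, hJ]
      conv_lhs => rw [this]
      simp only [Matrix.add_mul, Matrix.mul_assoc]
    rw [e]
    have hGt : ‖Gᵀ‖ ≤ 2 * w := by rwa [ntr]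
    have hYt : ‖Yᵀ‖ ≤ y := (ntr Y).le
    have j1 := nmul hQn (nmul hGt hPJP)
    have j2 := nmul hQpn (nmul hYt (nmul hJ1 hPn))
    have j3 := norm_add_le (Q * (Gᵀ * (Pᵀ * J * P))) (Qp * (Yᵀ * (J * P)))
    linarith
  -- final decomposition
  have hfin : Zn'ᵀ * Zn * Qsp = (J * Z)ᵀ * Z * Qp * S
      - μ • ((J * Z)ᵀ * P * (K * (F * S))) - (μ * μ) • ((J * Z)ᵀ * M * M * (Z * Qsp)) := by
    have k1 : Zn'ᵀ * Zn * Qsp = (J * Z)ᵀ * (Z * Qsp)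
        - (μ * μ) • ((J * Z)ᵀ * M * M * (Z * Qsp)) := by
      rw [hZn', hZn, Matrix.transpose_sub, Matrix.transpose_smul, Matrix.transpose_mul M, hM]
      simp only [Matrix.mul_add, Matrix.add_mul, Matrix.mul_sub, Matrix.sub_mul,
        Matrix.smul_mul, Matrix.mul_smul, Matrix.mul_assoc, smul_smul, smul_sub, smul_add]
      abel
    rw [k1]
    congr 1
    rw [hZQ, hY]
    simp only [Matrix.mul_sub, Matrix.mul_smul, Matrix.mul_assoc]
  rw [hfin]
  have l1 := nmul (le_refl ‖(J * Z)ᵀ * Z * Qp‖) hSn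
  have l2 := mul_le_mul_of_nonneg_left (nmul hJZP (nmul hKn (nmul hFn hSn))) hμ.le
  have l3 := mul_le_mul_of_nonneg_left (nmul (nmul (nmul hJZt hMn) hMn) hZQn)
    (mul_pos hμ hμ).le
  have l4 := norm_sub_le ((J * Z)ᵀ * Z * Qp * S - μ • ((J * Z)ᵀ * P * (K * (F * S))))
    ((μ * μ) • ((J * Z)ᵀ * M * M * (Z * Qsp)))
  have l5 := norm_sub_le ((J * Z)ᵀ * Z * Qp * S) (μ • ((J * Z)ᵀ * P * (K * (F * S))))
  rw [norm_smul, Real.norm_of_nonneg (mul_pos hμ hμ).le] at l4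
  rw [norm_smul, Real.norm_of_nonneg hμ.le] at l5
  have hθ : 2 * s + 22 * (μ * x) ≤ 1 := by linarith
  have l6 : (4 * w * s + y) * (1 + 2 * s + 22 * (μ * x)) ≤ y + (12 * s + 44 * (μ * x)) * w := by
    have p1 : y * (2 * s + 22 * (μ * x)) ≤ 2 * w * (2 * s + 22 * (μ * x)) :=
      mul_le_mul_of_nonneg_right hy2 (by positivity)
    have p2 : 4 * w * s * (2 * s + 22 * (μ * x)) ≤ 4 * w * s * 1 :=
      mul_le_mul_of_nonneg_left hθ (by positivity)
    linarith
  have l7 := mul_le_mul_of_nonneg_right l6 (by positivity : 0 ≤ μ * (8 * β * y))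
  have l8 : 0 ≤ μ * β * y * w * s := by positivity
  have l9 : 0 ≤ μ * β * y * w * (μ * x) := by positivity
  have l10 : 0 ≤ μ * μ * x ^ 2 * w * y := by positivity
  linarith

lemma sqrt2_inv_sq : (Real.sqrt 2)⁻¹ * (Real.sqrt 2)⁻¹ = (1 / 2 : ℝ) := by
  rw [← mul_inv, Real.mul_self_sqrt (by norm_num)]; norm_num

lemma minner_sym {n₁ n₂ : ℕ} (B Y : Matrix (Fin n₁) (Fin n₂) ℝ) :
    minner (Matrix.fromBlocks 0 B Bᵀ 0) (symMat Y) = 2 * minner B Y := by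
  have h : ∑ j : Fin n₂, ∑ i : Fin n₁, B i j * Y i j = ∑ i, ∑ j, B i j * Y i j :=
    Finset.sum_comm
  simp [minner, symMat, Fintype.sum_sum_type, h]
  ring

lemma minner_smul_left {a b : Type*} [Fintype a] [Fintype b] (c : ℝ) (B Y : Matrix a b ℝ) :
    minner (c • B) Y = c * minner B Y := by
  simp [minner, Finset.mul_sum, mul_assoc]

lemma BstarB_sym {n₁ n₂ m : ℕ} (A : Fin m → Matrix (Fin n₁) (Fin n₂) ℝ)
    (Y : Matrix (Fin n₁) (Fin n₂) ℝ) : BstarB A (symMat Y) = symMat (AstarA A Y) := by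
  have h : ∀ i, minner (Bmat A i) (symMat Y) • Bmat A i
      = symMat (minner (A i) Y • A i) := by
    intro i
    rw [Bmat, minner_smul_left, minner_sym, smul_smul,
      show (Real.sqrt 2)⁻¹ * (2 * minner (A i) Y) * (Real.sqrt 2)⁻¹ = minner (A i) Y by
        linear_combination (2 * minner (A i) Y) * sqrt2_inv_sq]
    simp [symMat, Matrix.fromBlocks_smul]
  rw [BstarB, AstarA, Finset.sum_congr rfl fun i _ => h i]
  ext (i | i) (j | j) <;> simp [symMat, Matrix.sum_apply]

lemma symMat_norm {n₁ n₂ : ℕ} (X : Matrix (Fin n₁) (Fin n₂) ℝ) : ‖symMat X‖ ≤ 2 * ‖X‖ := by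
  set E1 : Matrix (Fin n₁ ⊕ Fin n₂) (Fin n₁) ℝ := Matrix.fromRows 1 0 with hE1
  set E2 : Matrix (Fin n₁ ⊕ Fin n₂) (Fin n₂) ℝ := Matrix.fromRows 0 1 with hE2
  have h1 : ‖E1‖ ≤ 1 := northo (by
    rw [hE1, Matrix.transpose_fromRows, Matrix.fromCols_mul_fromRows]; simp)
  have h2 : ‖E2‖ ≤ 1 := northo (by
    rw [hE2, Matrix.transpose_fromRows, Matrix.fromCols_mul_fromRows]; simp)
  have e : symMat X = E1 * X * E2ᵀ + E2 * Xᵀ * E1ᵀ := by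
    rw [hE1, hE2, Matrix.transpose_fromRows, Matrix.transpose_fromRows,
      Matrix.fromRows_mul 1 0 X, Matrix.fromRows_mul 0 1 Xᵀ, Matrix.fromRows_mul_fromCols,
      Matrix.fromRows_mul_fromCols, Matrix.fromBlocks_add]
    simp [symMat]
  have h1t : ‖E1ᵀ‖ ≤ 1 := by rwa [ntr]
  have h2t : ‖E2ᵀ‖ ≤ 1 := by rwa [ntr]
  have a1 := nmul (nmul h1 (le_refl ‖X‖)) h2t
  have a2 := nmul (nmul h2 (ntr X).le) h1t
  have a3 := norm_add_le (E1 * X * E2ᵀ) (E2 * Xᵀ * E1ᵀ)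
  rw [e]; linarith

lemma flip_mul_Zstack {n₁ n₂ k : ℕ} (V : Matrix (Fin n₁) (Fin k) ℝ) (W : Matrix (Fin n₂) (Fin k) ℝ) :
    flipSign n₁ n₂ * Zstack V W = Zstack V (-W) := by
  rw [flipSign, Zstack, Zstack, Matrix.mul_smul, Matrix.fromBlocks_mul_fromRows]
  simp

lemma symMat_mul_Zstack {n₁ n₂ k : ℕ} (X : Matrix (Fin n₁) (Fin n₂) ℝ)
    (V : Matrix (Fin n₁) (Fin k) ℝ) (W : Matrix (Fin n₂) (Fin k) ℝ) :
    symMat X * Zstack V W = Zstack (X * W) (Xᵀ * V) := by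
  rw [symMat, Zstack, Zstack, Matrix.mul_smul, Matrix.fromBlocks_mul_fromRows]
  simp

lemma Zstack_tr_mul {n₁ n₂ k l : ℕ}
    (V : Matrix (Fin n₁) (Fin k) ℝ) (W : Matrix (Fin n₂) (Fin k) ℝ)
    (V' : Matrix (Fin n₁) (Fin l) ℝ) (W' : Matrix (Fin n₂) (Fin l) ℝ) :
    (Zstack V W)ᵀ * Zstack V' W' = (1 / 2 : ℝ) • (Vᵀ * V' + Wᵀ * W') := by
  rw [Zstack, Zstack, Matrix.transpose_smul, Matrix.smul_mul, Matrix.mul_smul, smul_smul,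
    sqrt2_inv_sq, Matrix.transpose_fromRows, Matrix.fromCols_mul_fromRows]

lemma Zstack_mul_tr {n₁ n₂ k : ℕ}
    (V : Matrix (Fin n₁) (Fin k) ℝ) (W : Matrix (Fin n₂) (Fin k) ℝ) :
    Zstack V W * (Zstack V W)ᵀ - Zstack V (-W) * (Zstack V (-W))ᵀ = symMat (V * Wᵀ) := by
  have h : ∀ W : Matrix (Fin n₂) (Fin k) ℝ, Zstack V W * (Zstack V W)ᵀ
      = (1 / 2 : ℝ) • Matrix.fromBlocks (V * Vᵀ) (V * Wᵀ) (W * Vᵀ) (W * Wᵀ) := by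
    intro W
    rw [Zstack, Matrix.transpose_smul, Matrix.smul_mul, Matrix.mul_smul, smul_smul,
      sqrt2_inv_sq, Matrix.transpose_fromRows, Matrix.fromRows_mul_fromCols]
  rw [h, h, symMat, Matrix.transpose_mul, Matrix.transpose_transpose]
  ext (i | i) (j | j) <;> simp <;> ring

lemma specNorm_nonneg' {a b : Type*} [Fintype a] [Fintype b] [DecidableEq b]
    (M : Matrix a b ℝ) : 0 ≤ specNorm M := by
  rw [specNorm_eq]; exact norm_nonneg M

end Helpers

/-- control of the imbalance term parallel to the nuisance part. -/
theorem statement14_imbalance_nuisance :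
    ∃ c C : ℝ, 0 < c ∧ 0 < C ∧
    ∀
    (n₁ n₂ m k r : ℕ)
    (A : Fin m → Matrix (Fin n₁) (Fin n₂) ℝ) (X : Matrix (Fin n₁) (Fin n₂) ℝ)
    (PX : Matrix (Fin n₁) (Fin r) ℝ) (QX : Matrix (Fin n₂) (Fin r) ℝ) (σX : Fin r → ℝ)
    (hPX : PXᵀ * PX = 1) (hQX : QXᵀ * QX = 1)
    (hσpos : ∀ i, 0 < σX i) (hσanti : Antitone σX)
    (hXsvd : X = PX * Matrix.diagonal σX * QXᵀ)
    (μ : ℝ) (hμ : 0 < μ)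
    (V₀ : Matrix (Fin n₁) (Fin k) ℝ) (W₀ : Matrix (Fin n₂) (Fin k) ℝ)
    (Z Z' : ℕ → Matrix (Fin n₁ ⊕ Fin n₂) (Fin k) ℝ)
    (hZ : Z = Zit A X μ V₀ W₀) (hZ' : Z' = Ztil A X μ V₀ W₀)
    (LX : Matrix (Fin n₁ ⊕ Fin n₂) (Fin r) ℝ) (hLX : LX = Zstack PX QX)
    (κ σm : ℝ) (hκ : κ = condNum X) (hσm : σm = sigmaPos X)
    (Δ : ℕ → Matrix (Fin n₁ ⊕ Fin n₂) (Fin n₁ ⊕ Fin n₂) ℝ) (hΔ : Δ = Δit A X μ V₀ W₀)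
    (LXp : Matrix (Fin n₁ ⊕ Fin n₂) (Fin (n₁ + n₂ - r)) ℝ)
    (hLXp1 : LXpᵀ * LXp = 1) (hLXp2 : LXᵀ * LXp = 0)
    (t : ℕ)
    (Qt : Matrix (Fin k) (Fin r) ℝ) (hQt1 : Qtᵀ * Qt = 1)
    (hQt2 : LXᵀ * Z t * Qt * Qtᵀ = LXᵀ * Z t)
    (Qtp : Matrix (Fin k) (Fin (k - r)) ℝ) (hQtp1 : Qtpᵀ * Qtp = 1) (hQtp2 : Qtᵀ * Qtp = 0)
    (Qs : Matrix (Fin k) (Fin r) ℝ) (hQs1 : Qsᵀ * Qs = 1)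
    (hQs2 : LXᵀ * Z (t + 1) * Qs * Qsᵀ = LXᵀ * Z (t + 1))
    (Qsp : Matrix (Fin k) (Fin (k - r)) ℝ) (hQsp1 : Qspᵀ * Qsp = 1) (hQsp2 : Qsᵀ * Qsp = 0)
    (PZ : Matrix (Fin n₁ ⊕ Fin n₂) (Fin r) ℝ) (hPZ : IsOrthCol PZ (Z t * Qt))
    (h1 : IsUnit (LXᵀ * Z (t + 1) * Qt))
    (h2 : max (specNorm (Z t)) (specNorm (Z (t + 1))) ≤ 2 * Real.sqrt (specNorm X))
    (h3 : specNorm (LXpᵀ * PZ) ≤ c)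
    (h4 : μ ≤ c / (specNorm X * κ))
    (h5 : specNorm (Δ t) ≤ c * σm)
    (β : ℝ)
    (hβ : β = specNorm (LXpᵀ * PZ) * specNorm X + specNorm (Z t * Qtp) ^ 2 + specNorm (Δ t)),
    specNorm ((Z' (t + 1))ᵀ * Z (t + 1) * Qsp)
      ≤ specNorm ((Z' t)ᵀ * Z t * Qtp)
        + C * μ * ((specNorm (LXpᵀ * PZ) + μ * specNorm X) * β + μ * specNorm X ^ 2)
          * Real.sqrt (specNorm X) * specNorm (Z t * Qtp)
        + 8 * μ * β * specNorm (Z t * Qtp) ^ 2 := by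
  refine ⟨1 / 100, 500, by norm_num, by norm_num, ?_⟩
  intro n₁ n₂ m k r A X PX QX σX hPX hQX hσpos hσanti hXsvd μ hμ V₀ W₀ Z Z' hZ hZ' LX hLX κ σm
    hκ hσm Δ hΔ LXp hLXp1 hLXp2 t Qt hQt1 hQt2 Qtp hQtp1 hQtp2 Qs hQs1 hQs2 Qsp hQsp1 hQsp2
    PZ hPZ h1 h2 h3 h4 h5 β hβ
  -- numerical facts
  have hX0 : 0 ≤ specNorm X := specNorm_nonneg' X
  have hXσ : 0 < specNorm X * κ := by
    by_contra hneg
    have := div_nonpos_of_nonneg_of_nonpos (by norm_num : (0 : ℝ) ≤ 1 / 100) (not_lt.mp hneg)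
    linarith
  have hxpos : 0 < specNorm X :=
    lt_of_le_of_ne hX0 fun h => by rw [← h, zero_mul] at hXσ; exact lt_irrefl _ hXσ
  have hκpos : 0 < κ := (mul_pos_iff_of_pos_left hxpos).mp hXσ
  have hσmpos : 0 < σm := by
    rw [hκ, condNum, ← hσm] at hκpos
    exact (div_pos_iff_of_pos_left hxpos).mp hκpos
  have hσle : σm ≤ specNorm X := by
    rw [hσm] at hσmpos ⊢
    have hne : {c : ℝ | ∃ x : Fin n₂ → ℝ, euclNorm x = 1 ∧
        (∀ y : Fin n₂ → ℝ, X.mulVec y = 0 → x ⬝ᵥ y = 0) ∧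
          c = euclNorm (X.mulVec x)}.Nonempty := by
      by_contra hem
      rw [Set.not_nonempty_iff_eq_empty] at hem
      rw [sigmaPos, hem, Real.sInf_empty] at hσmpos
      exact lt_irrefl _ hσmpos
    obtain ⟨c, hc⟩ := hne
    have hle : sigmaPos X ≤ c := by
      refine csInf_le ⟨0, ?_⟩ hc
      rintro _ ⟨x, _, _, rfl⟩
      exact Real.sqrt_nonneg _
    obtain ⟨x, hx1, _, rfl⟩ := hc
    have := euclNorm_mulVec_le X x
    rw [hx1, mul_one, ← specNorm_eq] at this
    exact hle.trans this
  have hκ1 : 1 ≤ κ := by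
    rw [hκ, condNum, ← hσm, le_div_iff₀ hσmpos]; linarith
  have hμx : μ * specNorm X ≤ 1 / 100 := by
    rw [le_div_iff₀ hXσ] at h4
    have : μ * specNorm X * 1 ≤ μ * specNorm X * κ :=
      mul_le_mul_of_nonneg_left hκ1 (by positivity)
    linarith
  -- structural facts
  set V := (iter A X μ V₀ W₀ t).1 with hV
  set W := (iter A X μ V₀ W₀ t).2 with hW
  set G := AstarA A (V * Wᵀ - X) with hG
  have hZt : Z t = Zstack V W := by rw [hZ]; rfl
  have hZ't : Z' t = flipSign n₁ n₂ * Z t := by rw [hZt, flip_mul_Zstack, hZ']; rfl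
  have hZn : Z (t + 1) = Zstack (V - μ • (G * W)) (W - μ • (Gᵀ * V)) := by rw [hZ]; rfl
  have hZn' : Z' (t + 1) = Zstack (V - μ • (G * W)) (-(W - μ • (Gᵀ * V))) := by rw [hZ']; rfl
  have hneg : ∀ Y : Matrix (Fin n₁) (Fin n₂) ℝ, symMat (-Y) = - symMat Y := by
    intro Y; simp [symMat, Matrix.fromBlocks_neg]
  have hsub : ∀ Y Y' : Matrix (Fin n₁) (Fin n₂) ℝ, symMat (Y - Y') = symMat Y - symMat Y' := by
    intro Y Y'
    ext (i | i) (j | j) <;> simp [symMat]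
  have hD : Z t * (Z t)ᵀ - (flipSign n₁ n₂ * Z t) * (flipSign n₁ n₂ * Z t)ᵀ - symMat X
      = symMat (V * Wᵀ - X) := by
    rw [hZt, flip_mul_Zstack, Zstack_mul_tr, hsub]
  have hΔt : Δ t = symMat (V * Wᵀ - X) - symMat G := by
    rw [hG, ← BstarB_sym, ← hD, ← hZ't, hΔ, hZ, hZ']; rfl
  have hr1 : r ≤ n₁ := ortho_card hPX
  have hrk : r ≤ k := ortho_card hQt1
  have hLL : LXᵀ * LX = 1 := by
    rw [hLX, Zstack_tr_mul, hPX, hQX, ← two_smul ℝ, smul_smul]; norm_num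
  have hPZ' := hPZ
  obtain ⟨hP1, -, hP3⟩ := hPZ'
  simp only [specNorm_eq] at h2 h3 h5 hβ hμx hσle hX0 ⊢
  rw [hZ't]
  open scoped Matrix.Norms.L2Operator in
  refine core (Z t) (Z (t + 1)) (Z' (t + 1)) (flipSign n₁ n₂) (symMat (-G)) (symMat X) (Δ t)
    LX PZ LXp Qt Qtp Qsp (Matrix.diagonal σX) μ ‖X‖ (Real.sqrt ‖X‖) ?_ ?_ ?_ ?_ ?_ hLL hLXp1
    ?_ ?_ hQt1 hQt2 ?_ hQtp1 hQtp2 hQsp1 ?_ hP1 hP3 h1 ?_ ?_ hμ (Real.sqrt_nonneg _)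
    (Real.sq_sqrt hX0) ((le_max_left _ _).trans h2) (symMat_norm X) h3 hμx ?_ β hβ
  · simp [flipSign, Matrix.fromBlocks_transpose]
  · apply northo
    simp [flipSign, Matrix.fromBlocks_transpose, Matrix.fromBlocks_multiply]
  · simp [symMat, Matrix.fromBlocks_transpose]
  · rw [hΔt, ← hD, hneg]; abel
  · have h : symMat X * LX = LX * Matrix.diagonal σX := by
      have e1 : X * QX = PX * Matrix.diagonal σX := by
        rw [hXsvd, Matrix.mul_assoc, hQX, Matrix.mul_one]
      have e2 : Xᵀ * PX = QX * Matrix.diagonal σX := by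
        rw [hXsvd, Matrix.transpose_mul, Matrix.transpose_mul, Matrix.transpose_transpose,
          Matrix.diagonal_transpose, Matrix.mul_assoc, Matrix.mul_assoc, hPX, Matrix.mul_one]
      rw [hLX, symMat_mul_Zstack, e1, e2, Zstack, Zstack, Matrix.smul_mul, Matrix.fromRows_mul]
    have h' := congrArg Matrix.transpose h
    rw [Matrix.transpose_mul, Matrix.transpose_mul, Matrix.diagonal_transpose] at h'
    rw [← h']
    simp [symMat, Matrix.fromBlocks_transpose]
  · refine ortho_compl hLL hLXp1 hLXp2 ?_
    simp only [Fintype.card_sum, Fintype.card_fin]; omega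
  · rw [Matrix.mul_assoc, hLX, flip_mul_Zstack, Zstack_tr_mul, Matrix.mul_neg, hPX, hQX]; simp
  · refine ortho_compl hQt1 hQtp1 hQtp2 ?_
    simp only [Fintype.card_fin]; omega
  · rw [← hQs2, Matrix.mul_assoc, hQsp2, Matrix.mul_zero]
  · rw [hZn, hZt, symMat_mul_Zstack]
    simp only [Zstack]
    ext (i | i) j <;> simp <;> ring
  · rw [hZn', hZt, flip_mul_Zstack, symMat_mul_Zstack]
    simp only [Zstack]
    ext (i | i) j <;> simp <;> ring
  · linarith

end AsymMatrixSensing
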